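/- Let R be a commutative ring, M a projective R-module, and T the tensor algebra of M over R. Equip T with the module structure over the enveloping algebra T ⊗[R] Tᵐᵒᵖ given by (a ⊗ bᵒᵖ) • t = a * t * b. Then there exists a short exact sequence of (T ⊗[R] Tᵐᵒᵖ)-modules 0 → P₁ → P₀ → T → 0 in which both P₀ and P₁ are projective (T ⊗[R] Tᵐᵒᵖ)-modules; in other words, T has projective dimension at most 1 as a bimodule over itself. -/

import Mathlib

open TensorProduct MulOpposite

set_option maxSynthPendingDepth 2

namespace TensorAlgebra

variable (R : Type*) [CommRing R] (M : Type*) [AddCommGroup M] [Module R M]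

/-- The enveloping algebra of the tensor algebra. -/
abbrev Envelope : Type _ := TensorAlgebra R M ⊗[R] (TensorAlgebra R M)ᵐᵒᵖ

/-- The noncommutative differential `ι m ⊗ 1 - 1 ⊗ ι m` of a generator of the tensor algebra. -/
def envelopeDiff : M →ₗ[R] Envelope R M :=
  (TensorProduct.mk R _ _).flip 1 ∘ₗ ι R -
    TensorProduct.mk R _ _ 1 ∘ₗ (opLinearEquiv R).toLinearMap ∘ₗ ι R

variable {R M} in
@[simp]
theorem envelopeDiff_apply (m : M) :
    envelopeDiff R M m = ι R m ⊗ₜ[R] 1 - 1 ⊗ₜ[R] op (ι R m) := rfl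

/-- The map `T ⊗ M ⊗ T → T ⊗ T` of the small bimodule resolution of the tensor algebra `T`. -/
def resolutionMap : Envelope R M ⊗[R] M →ₗ[Envelope R M] Envelope R M :=
  TensorProduct.AlgebraTensorModule.lift
    (LinearMap.toSpanSingleton (Envelope R M) (M →ₗ[R] Envelope R M) (envelopeDiff R M))

variable {R M} in
@[simp]
theorem resolutionMap_tmul (e : Envelope R M) (m : M) :
    resolutionMap R M (e ⊗ₜ[R] m) = e * envelopeDiff R M m := rfl

/-- The representation of the tensor algebra `T` on `(T ⊗ M ⊗ T) × T` whose off-diagonal entry is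
the universal derivation of `T`. -/
def derivationRep : TensorAlgebra R M →ₐ[R]
    Module.End R ((Envelope R M ⊗[R] M) × TensorAlgebra R M) :=
  lift R <| LinearMap.mk₂ R
    (fun m p ↦ ((ι R m ⊗ₜ[R] (1 : (TensorAlgebra R M)ᵐᵒᵖ) : Envelope R M) • p.1 +
      ((1 : TensorAlgebra R M) ⊗ₜ[R] op p.2) ⊗ₜ[R] m, ι R m * p.2))
    (fun m m' p ↦ by
      ext1 <;> simp only [map_add, add_tmul, tmul_add, add_smul, add_mul, Prod.fst_add,
        Prod.snd_add]
      abel)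
    (fun c m p ↦ by
      ext1 <;> simp only [map_smul, ← smul_tmul', tmul_smul, smul_assoc, smul_mul_assoc,
        Prod.smul_fst, Prod.smul_snd, smul_add])
    (fun m p q ↦ by
      ext1 <;> simp only [op_add, add_tmul, tmul_add, smul_add, mul_add, Prod.fst_add,
        Prod.snd_add]
      abel)
    (fun c m p ↦ by
      ext1 <;> simp only [op_smul, ← smul_tmul', tmul_smul, smul_comm _ c, mul_smul_comm,
        Prod.smul_fst, Prod.smul_snd, smul_add])

variable {R M} in
@[simp]
theorem derivationRep_ι (m : M) (p : (Envelope R M ⊗[R] M) × TensorAlgebra R M) :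
    derivationRep R M (ι R m) p =
      ((ι R m ⊗ₜ[R] (1 : (TensorAlgebra R M)ᵐᵒᵖ) : Envelope R M) • p.1 +
        ((1 : TensorAlgebra R M) ⊗ₜ[R] op p.2) ⊗ₜ[R] m, ι R m * p.2) := by
  simp [derivationRep]

variable {R M} in
@[simp]
theorem derivationRep_snd (t : TensorAlgebra R M)
    (p : (Envelope R M ⊗[R] M) × TensorAlgebra R M) :
    (derivationRep R M t p).2 = t * p.2 := by
  induction t using TensorAlgebra.induction generalizing p with
  | algebraMap r => simp [Algebra.smul_def]
  | ι m => simp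
  | mul a b ha hb => simp [ha, hb, mul_assoc]
  | add a b ha hb => simp [ha, hb, add_mul]

/-- The universal derivation `T → T ⊗ M ⊗ T` of the tensor algebra `T`. -/
def universalDerivation : TensorAlgebra R M →ₗ[R] Envelope R M ⊗[R] M :=
  LinearMap.fst R _ _ ∘ₗ LinearMap.applyₗ (0, 1) ∘ₗ (derivationRep R M).toLinearMap

variable {R M} in
theorem universalDerivation_ι_mul (m : M) (t : TensorAlgebra R M) :
    universalDerivation R M (ι R m * t) =
      (ι R m ⊗ₜ[R] (1 : (TensorAlgebra R M)ᵐᵒᵖ) : Envelope R M) • universalDerivation R M t +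
        ((1 : TensorAlgebra R M) ⊗ₜ[R] op t) ⊗ₜ[R] m := by
  simp [universalDerivation]

/-- The contracting homotopy `a ⊗ b ↦ -a • D b` of the small resolution, where `D` is the universal
derivation. -/
def resolutionRetraction : Envelope R M →ₗ[R] Envelope R M ⊗[R] M :=
  TensorProduct.lift <| LinearMap.mk₂ R
    (fun a b ↦ -((a ⊗ₜ[R] (1 : (TensorAlgebra R M)ᵐᵒᵖ) : Envelope R M) •
      universalDerivation R M b.unop))
    (fun a a' b ↦ by simp only [add_tmul, add_smul, neg_add])
    (fun c a b ↦ by simp only [← smul_tmul', smul_assoc, smul_neg])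
    (fun a b b' ↦ by simp only [unop_add, map_add, smul_add, neg_add])
    (fun c a b ↦ by simp only [unop_smul, map_smul, smul_comm _ c, smul_neg])

variable {R M} in
@[simp]
theorem resolutionRetraction_tmul (a : TensorAlgebra R M) (b : (TensorAlgebra R M)ᵐᵒᵖ) :
    resolutionRetraction R M (a ⊗ₜ[R] b) =
      -((a ⊗ₜ[R] (1 : (TensorAlgebra R M)ᵐᵒᵖ) : Envelope R M) •
        universalDerivation R M b.unop) := rfl

theorem leftInverse_resolutionRetraction :
    Function.LeftInverse (resolutionRetraction R M) (resolutionMap R M) := by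
  intro x
  induction x using TensorProduct.induction_on with
  | zero => simp
  | add x y hx hy => rw [map_add, map_add, hx, hy]
  | tmul e m =>
    induction e using TensorProduct.induction_on with
    | zero => simp
    | add x y hx hy => rw [add_tmul, map_add, map_add, hx, hy]
    | tmul a b =>
      simp [mul_sub, universalDerivation_ι_mul, smul_add, smul_smul, smul_tmul']

theorem resolutionMap_injective : Function.Injective (resolutionMap R M) :=
  (leftInverse_resolutionRetraction R M).injective

variable {R M} in
theorem tmul_one_sub_one_tmul_mem_range_resolutionMap (t : TensorAlgebra R M) :
    (t ⊗ₜ[R] 1 - 1 ⊗ₜ[R] op t : Envelope R M) ∈ LinearMap.range (resolutionMap R M) := by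
  induction t using TensorAlgebra.induction with
  | algebraMap r => simp [Algebra.algebraMap_eq_smul_one, smul_tmul']
  | ι m => exact ⟨1 ⊗ₜ m, by simp⟩
  | add a b ha hb =>
    convert! add_mem ha hb using 1
    simp only [add_tmul, op_add, tmul_add]
    abel
  | mul a b ha hb =>
    convert! add_mem (Submodule.smul_mem _ (a ⊗ₜ[R] (1 : (TensorAlgebra R M)ᵐᵒᵖ)) hb)
      (Submodule.smul_mem _ ((1 : TensorAlgebra R M) ⊗ₜ[R] op b) ha) using 1
    simp [mul_sub]

variable {R M} in
theorem sub_mem_range_resolutionMap (a b : TensorAlgebra R M) :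
    (a ⊗ₜ[R] op b - (a * b) ⊗ₜ[R] 1 : Envelope R M) ∈ LinearMap.range (resolutionMap R M) := by
  convert! neg_mem (Submodule.smul_mem _ (a ⊗ₜ[R] (1 : (TensorAlgebra R M)ᵐᵒᵖ))
    (tmul_one_sub_one_tmul_mem_range_resolutionMap b)) using 1
  simp [mul_sub]

end TensorAlgebra

/-- Let `R` be a commutative ring, `M` a projective `R`-module and `T = TensorAlgebra R M`.
Equip `T` with the module structure over the enveloping algebra `T ⊗[R] Tᵐᵒᵖ` for which
`(a ⊗ bᵒᵖ) • t = a * t * b`.  Then there is a short exact sequence of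
`(T ⊗[R] Tᵐᵒᵖ)`-modules `0 → P₁ → P₀ → T → 0` with `P₀` and `P₁` projective; in other
words, `T` has projective dimension at most `1` as a bimodule over itself. -/
theorem tensor_algebra_homologically_smooth.{u, v}
    (R : Type u) [CommRing R] (M : Type v) [AddCommGroup M] [Module R M]
    (hM : Module.Projective R M)
    (inst : Module (TensorAlgebra R M ⊗[R] (TensorAlgebra R M)ᵐᵒᵖ) (TensorAlgebra R M))
    (hsmul : ∀ (a b t : TensorAlgebra R M),
      letI := inst
      (a ⊗ₜ[R] op b) • t = a * t * b) :
    letI := inst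
    ∃ (P₁ P₀ : Type (max u v)) (_ : AddCommGroup P₁) (_ : AddCommGroup P₀)
      (_ : Module (TensorAlgebra R M ⊗[R] (TensorAlgebra R M)ᵐᵒᵖ) P₁)
      (_ : Module (TensorAlgebra R M ⊗[R] (TensorAlgebra R M)ᵐᵒᵖ) P₀)
      (f : P₁ →ₗ[TensorAlgebra R M ⊗[R] (TensorAlgebra R M)ᵐᵒᵖ] P₀)
      (g : P₀ →ₗ[TensorAlgebra R M ⊗[R] (TensorAlgebra R M)ᵐᵒᵖ] TensorAlgebra R M),
      Module.Projective (TensorAlgebra R M ⊗[R] (TensorAlgebra R M)ᵐᵒᵖ) P₁ ∧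
      Module.Projective (TensorAlgebra R M ⊗[R] (TensorAlgebra R M)ᵐᵒᵖ) P₀ ∧
      Function.Injective f ∧ Function.Surjective g ∧
      LinearMap.range f = LinearMap.ker g := by
  let := inst
  have hg (a b : TensorAlgebra R M) :
      (a ⊗ₜ[R] op b : TensorAlgebra.Envelope R M) • (1 : TensorAlgebra R M) = a * b := by
    rw [hsmul, mul_one]
  refine ⟨TensorAlgebra.Envelope R M ⊗[R] M, TensorAlgebra.Envelope R M, inferInstance,
    inferInstance, inferInstance, inferInstance, TensorAlgebra.resolutionMap R M,
    LinearMap.toSpanSingleton _ _ 1, inferInstance, inferInstance,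
    TensorAlgebra.resolutionMap_injective R M,
    fun t ↦ ⟨t ⊗ₜ[R] op 1, by simpa using hg t 1⟩, le_antisymm ?_ fun e he ↦ ?_⟩
  · rintro _ ⟨x, rfl⟩
    induction x using TensorProduct.induction_on with
    | zero => simp
    | add x y hx hy => rw [map_add]; exact add_mem hx hy
    | tmul e m =>
      have h₁ := hg (TensorAlgebra.ι R m) 1
      have h₂ := hg 1 (TensorAlgebra.ι R m)
      rw [op_one, mul_one] at h₁
      rw [one_mul] at h₂
      simp [mul_smul, sub_smul, h₁, h₂]
  · have key (e : TensorAlgebra.Envelope R M) :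
        e - (e • (1 : TensorAlgebra R M)) ⊗ₜ[R] 1 ∈
          LinearMap.range (TensorAlgebra.resolutionMap R M) := by
      induction e using TensorProduct.induction_on with
      | zero => simp
      | tmul a b =>
        have := TensorAlgebra.sub_mem_range_resolutionMap a b.unop
        rwa [← hg, op_unop] at this
      | add x y hx hy =>
        rw [add_smul, add_tmul, add_sub_add_comm]
        exact add_mem hx hy
    have he' : e • (1 : TensorAlgebra R M) = 0 := by simpa using he
    simpa [he'] using key e
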